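/- For every integer u with u ≡ 8 (mod 12) and u ≥ 20, there exists a 2-cyclic 3-IGDD of type 2^{(u,5)}. -/

import Mathlib

/-- An h-cyclic 3-IGDD of type (gh)^{(u,t)}: blocks on `I_u × I_g × Z_h` with
groups `{i} × I_g × Z_h` (i ∈ I_u) and hole `Y = I_t × I_g × Z_h` (the union
of the first t groups). Every block meets each group in at most one point, no
block contains two points of Y, every pair of points from distinct groups not
both in Y lies in exactly one block, and the cyclic shift of the last
coordinate maps the block set onto itself. -/
def IsCyclicIGDDcol (u g h t : ℕ)
    (ℬ : Finset (Finset (Fin u × Fin g × ZMod h))) : Prop :=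
  (∀ B ∈ ℬ, B.card = 3) ∧
  (∀ B ∈ ℬ, ∀ p ∈ B, ∀ q ∈ B, p ≠ q →
    p.1 ≠ q.1 ∧ ¬((p.1 : ℕ) < t ∧ (q.1 : ℕ) < t)) ∧
  (∀ p q : Fin u × Fin g × ZMod h, p.1 ≠ q.1 →
    ¬((p.1 : ℕ) < t ∧ (q.1 : ℕ) < t) →
    ∃! B, B ∈ ℬ ∧ p ∈ B ∧ q ∈ B) ∧
  (∀ B ∈ ℬ, B.image (fun p => (p.1, p.2.1, p.2.2 + 1)) ∈ ℬ)

/-- A symmetric ternary relation in which any two admissible points have a unique third point,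
and which is invariant under the shift, yields a cyclic incomplete group divisible design. -/
theorem exists_isCyclicIGDDcol_of_rel {u g h t : ℕ} [NeZero h]
    (T : Fin u × Fin g × ZMod h → Fin u × Fin g × ZMod h → Fin u × Fin g × ZMod h → Prop)
    (swap_left : ∀ p q r, T p q r → T q p r) (swap_right : ∀ p q r, T p q r → T p r q)
    (adm : ∀ p q r, T p q r → p.1 ≠ q.1 ∧ ¬((p.1 : ℕ) < t ∧ (q.1 : ℕ) < t))
    (third : ∀ p q, p.1 ≠ q.1 → ¬((p.1 : ℕ) < t ∧ (q.1 : ℕ) < t) → ∃ r, T p q r)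
    (third_unique : ∀ p q r r', T p q r → T p q r' → r = r')
    (shift : ∀ p q r, T p q r →
      T (p.1, p.2.1, p.2.2 + 1) (q.1, q.2.1, q.2.2 + 1) (r.1, r.2.1, r.2.2 + 1)) :
    ∃ ℬ : Finset (Finset (Fin u × Fin g × ZMod h)), IsCyclicIGDDcol u g h t ℬ := by
  classical
  have : Fintype (ZMod h) := ZMod.fintype h
  have ne : ∀ p q r, T p q r → p ≠ q := fun p q r hT hpq => (adm p q r hT).1 (congrArg _ hpq)
  have mem_block : ∀ a b c p q, T a b c → p ∈ ({a, b, c} : Finset _) →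
      q ∈ ({a, b, c} : Finset _) → p ≠ q →
      ∃ r, T p q r ∧ ({a, b, c} : Finset _) = {p, q, r} := by
    intro a b c p q hT hp hq hpq
    have h₁ := swap_left _ _ _ hT
    have h₂ := swap_right _ _ _ hT
    have h₃ := swap_right _ _ _ h₁
    have h₄ := swap_left _ _ _ h₂
    have h₅ := swap_left _ _ _ h₃
    simp only [Finset.mem_insert, Finset.mem_singleton] at hp hq
    rcases hp with rfl | rfl | rfl <;> rcases hq with rfl | rfl | rfl <;>
      first
      | exact absurd rfl hpq
      | exact ⟨_, by assumption, rfl⟩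
      | exact ⟨_, by assumption, by ext; simp only [Finset.mem_insert, Finset.mem_singleton]; tauto⟩
  refine ⟨Finset.univ.filter fun B => ∃ p q r, T p q r ∧ B = {p, q, r}, ?_, ?_, ?_, ?_⟩
  · intro B hB
    obtain ⟨p, q, r, hT, rfl⟩ := (Finset.mem_filter.1 hB).2
    exact Finset.card_eq_three.2 ⟨p, q, r, ne _ _ _ hT, ne _ _ _ (swap_right _ _ _ hT),
      ne _ _ _ (swap_right _ _ _ (swap_left _ _ _ hT)), rfl⟩
  · intro B hB p hp q hq hpq
    obtain ⟨a, b, c, hT, rfl⟩ := (Finset.mem_filter.1 hB).2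
    obtain ⟨r, hr, -⟩ := mem_block a b c p q hT hp hq hpq
    exact adm p q r hr
  · intro p q hpq hhole
    obtain ⟨r, hr⟩ := third p q hpq hhole
    refine ⟨{p, q, r}, ⟨Finset.mem_filter.2 ⟨Finset.mem_univ _, p, q, r, hr, rfl⟩, by simp, by simp⟩, ?_⟩
    rintro B ⟨hB, hp, hq⟩
    obtain ⟨a, b, c, hT, rfl⟩ := (Finset.mem_filter.1 hB).2
    obtain ⟨r', hr', heq⟩ := mem_block a b c p q hT hp hq (ne _ _ _ hr)
    rw [heq, third_unique p q r r' hr hr']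
  · intro B hB
    obtain ⟨a, b, c, hT, rfl⟩ := (Finset.mem_filter.1 hB).2
    refine Finset.mem_filter.2 ⟨Finset.mem_univ _, _, _, _, shift a b c hT, ?_⟩
    simp [Finset.image_insert]

namespace CyclicIGDD

/-- The five odd differences modulo `24 k + 6` joined to the groups of the hole. -/
def holeDiff (k i : ℤ) : ℤ :=
  if i = 0 then 1 else if i = 1 then 3 else if i = 2 then 6 * k - 1
  else if i = 3 then 6 * k + 1 else 10 * k + 1

/-- The differences covered by the base blocks `{0, a, a + b}`. -/
def IsBlockDiff (k z : ℤ) : Prop :=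
  -(12 * k + 2) ≤ z ∧ z ≤ 12 * k + 2 ∧ z ≠ 0 ∧ z ≠ 1 ∧ z ≠ -1 ∧ z ≠ 3 ∧ z ≠ -3 ∧
    z ≠ 6 * k - 1 ∧ z ≠ -(6 * k - 1) ∧ z ≠ 6 * k + 1 ∧ z ≠ -(6 * k + 1) ∧
    z ≠ 10 * k + 1 ∧ z ≠ -(10 * k + 1)

/-- For a positive difference `d`, the element `e` such that `{0, d, e}` is a translate of one of
the base blocks `{0, a, a + b}`, where `(a, b)` is `(2 r + 1, 6 k - r)` with `2 ≤ r < 2 k`,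
`(2 r, 10 k + 1 - r)` with `1 ≤ r ≤ 2 k`, or `(6 k, 6 k + 2)`. -/
def posThird (k d : ℤ) : ℤ :=
  if d = 6 * k then 12 * k + 2 else if d = 6 * k + 2 then -(6 * k)
  else if d = 12 * k + 2 then 6 * k
  else if d ≤ 4 * k then if d % 2 = 0 then 10 * k + 1 + d / 2 else 6 * k + 1 + d / 2
  else if d ≤ 8 * k then 2 * d - 12 * k - 1 else 2 * d - 20 * k - 2

/-- The extension of `posThird` to all differences. -/
def thirdDiff (k z : ℤ) : ℤ :=
  if 0 < z then posThird k z else posThird k (-z) + z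

theorem IsBlockDiff.neg {k z : ℤ} (h : IsBlockDiff k z) : IsBlockDiff k (-z) := by
  unfold IsBlockDiff at *
  refine ⟨?_, ?_, ?_, ?_, ?_, ?_, ?_, ?_, ?_, ?_, ?_, ?_, ?_⟩ <;> omega

theorem thirdDiff_neg {k z : ℤ} (h : IsBlockDiff k z) :
    thirdDiff k (-z) = thirdDiff k z - z := by
  have := h.2.2.1
  unfold thirdDiff
  rw [neg_neg]
  split_ifs <;> omega

theorem IsBlockDiff.thirdDiff {k z : ℤ} (hk : 1 ≤ k) (h : IsBlockDiff k z) :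
    IsBlockDiff k (thirdDiff k z) := by
  unfold IsBlockDiff at *
  unfold CyclicIGDD.thirdDiff posThird
  split_ifs <;> refine ⟨?_, ?_, ?_, ?_, ?_, ?_, ?_, ?_, ?_, ?_, ?_, ?_, ?_⟩ <;> omega

set_option maxHeartbeats 1000000 in
theorem thirdDiff_thirdDiff {k z : ℤ} (hk : 1 ≤ k) (h : IsBlockDiff k z) :
    CyclicIGDD.thirdDiff k (CyclicIGDD.thirdDiff k z) = z := by
  unfold IsBlockDiff at h
  generalize hw : CyclicIGDD.thirdDiff k z = w
  unfold CyclicIGDD.thirdDiff posThird at hw ⊢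
  split_ifs at hw <;> split_ifs <;> omega

/-- The difference from the point `(i, s)` to the point `(j, t)` is `z` modulo `24 k + 6`, where
`ℤ / (24 k + 6)` is identified with `ℤ / (12 k + 3) × ℤ / 2`. -/
def HasDiff (k : ℤ) {u : ℕ} (p q : Fin u × Fin 1 × ZMod 2) (z : ℤ) : Prop :=
  ((q.1 : ℤ) - p.1 = z ∨ (q.1 : ℤ) - p.1 = z + (12 * k + 3) ∨
    (q.1 : ℤ) - p.1 = z - (12 * k + 3)) ∧
  ((q.2.2.val : ℤ) - p.2.2.val - z) % 2 = 0

/-- The blocks without a point in the hole, with their points in any order. -/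
def OuterRel (k : ℤ) {u : ℕ} (p q r : Fin u × Fin 1 × ZMod 2) : Prop :=
  5 ≤ (p.1 : ℤ) ∧ 5 ≤ (q.1 : ℤ) ∧ 5 ≤ (r.1 : ℤ) ∧
    ∃ z, IsBlockDiff k z ∧ HasDiff k p q z ∧ HasDiff k p r (thirdDiff k z)

/-- The blocks whose first point lies in the hole. -/
def HoleRel (k : ℤ) {u : ℕ} (p q r : Fin u × Fin 1 × ZMod 2) : Prop :=
  (p.1 : ℤ) < 5 ∧ 5 ≤ (q.1 : ℤ) ∧ 5 ≤ (r.1 : ℤ) ∧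
    (q.2.2.val = p.2.2.val ∧ HasDiff k q r (holeDiff k p.1) ∨
      q.2.2.val ≠ p.2.2.val ∧ HasDiff k q r (-holeDiff k p.1))

/-- All blocks, with their points in any order. -/
def BlockRel (k : ℤ) {u : ℕ} (p q r : Fin u × Fin 1 × ZMod 2) : Prop :=
  OuterRel k p q r ∨ HoleRel k p q r ∨ HoleRel k q p r ∨ HoleRel k r p q

section

variable {k : ℤ} {u : ℕ} {p q r : Fin u × Fin 1 × ZMod 2} {z w : ℤ}

theorem point_ext (h₁ : (p.1 : ℤ) = q.1) (h₂ : (p.2.2.val : ℤ) = q.2.2.val) : p = q :=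
  Prod.ext (Fin.ext (by omega))
    (Prod.ext (Subsingleton.elim _ _) (ZMod.val_injective 2 (by omega)))

theorem exists_point (i s : ℤ) (hi : 0 ≤ i) (hiu : i < u) :
    ∃ p : Fin u × Fin 1 × ZMod 2, (p.1 : ℤ) = i ∧ ((p.2.2.val : ℤ) - s) % 2 = 0 := by
  refine ⟨(⟨i.toNat, by omega⟩, 0, (s : ZMod 2)), by simpa using hi, ?_⟩
  have := ZMod.val_intCast (n := 2) s
  dsimp only
  omega

theorem val_add_one (x : ZMod 2) : ((x + 1).val : ℤ) = 1 - x.val := by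
  revert x; decide

theorem HasDiff.symm (h : HasDiff k p q z) : HasDiff k q p (-z) := by
  unfold HasDiff at *
  omega

theorem HasDiff.sub (hu : (u : ℤ) = 12 * k + 8) (hq : 5 ≤ (q.1 : ℤ))
    (hr : 5 ≤ (r.1 : ℤ)) (hz : HasDiff k p q z) (hw : HasDiff k p r w)
    (h₁ : -(12 * k + 2) ≤ w - z) (h₂ : w - z ≤ 12 * k + 2) : HasDiff k q r (w - z) := by
  unfold HasDiff at *
  omega

theorem HasDiff.unique (hz : HasDiff k p q z) (hw : HasDiff k p q w)
    (h₁ : -(12 * k + 2) ≤ z) (h₂ : z ≤ 12 * k + 2)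
    (h₃ : -(12 * k + 2) ≤ w) (h₄ : w ≤ 12 * k + 2) : z = w := by
  unfold HasDiff at *
  omega

theorem HasDiff.point_unique (hu : (u : ℤ) = 12 * k + 8) (hq : 5 ≤ (q.1 : ℤ))
    (hr : 5 ≤ (r.1 : ℤ)) (h : HasDiff k p q z) (h' : HasDiff k p r z) : q = r := by
  have := q.2.2.val_lt
  have := r.2.2.val_lt
  unfold HasDiff at *
  exact point_ext (by omega) (by omega)

theorem HasDiff.exists_point (hu : (u : ℤ) = 12 * k + 8) (hp : 5 ≤ (p.1 : ℤ))
    (h₁ : -(12 * k + 2) ≤ z) (h₂ : z ≤ 12 * k + 2) :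
    ∃ q : Fin u × Fin 1 × ZMod 2, 5 ≤ (q.1 : ℤ) ∧ HasDiff k p q z := by
  obtain ⟨i, hi⟩ : ∃ i : ℤ, 5 ≤ i ∧ i < u ∧
      (i - p.1 = z ∨ i - p.1 = z + (12 * k + 3) ∨ i - p.1 = z - (12 * k + 3)) := by
    rcases lt_or_ge ((p.1 : ℤ) + z) 5 with h | h
    · exact ⟨p.1 + z + (12 * k + 3), by omega⟩
    · rcases lt_or_ge ((p.1 : ℤ) + z) u with h' | h'
      · exact ⟨p.1 + z, by omega⟩
      · exact ⟨p.1 + z - (12 * k + 3), by omega⟩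
  obtain ⟨q, hq, hs⟩ := CyclicIGDD.exists_point i (p.2.2.val + z) (by omega) hi.2.1
  exact ⟨q, by omega, by rw [hq]; exact hi.2.2, by omega⟩

theorem exists_hasDiff (hu : (u : ℤ) = 12 * k + 8) (hp : 5 ≤ (p.1 : ℤ)) (hq : 5 ≤ (q.1 : ℤ))
    (hpq : (p.1 : ℤ) ≠ q.1) :
    ∃ z, HasDiff k p q z ∧ -(12 * k + 2) ≤ z ∧ z ≤ 12 * k + 2 ∧ z ≠ 0 := by
  unfold HasDiff
  by_cases h : ((q.2.2.val : ℤ) - p.2.2.val - (q.1 - p.1)) % 2 = 0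
  · exact ⟨q.1 - p.1, by omega⟩
  · rcases lt_or_gt_of_ne hpq with h' | h'
    · exact ⟨q.1 - p.1 - (12 * k + 3), by omega⟩
    · exact ⟨q.1 - p.1 + (12 * k + 3), by omega⟩

theorem isBlockDiff_or_holeDiff (h₁ : -(12 * k + 2) ≤ z) (h₂ : z ≤ 12 * k + 2) (h₀ : z ≠ 0) :
    IsBlockDiff k z ∨ ∃ i, 0 ≤ i ∧ i < 5 ∧ (z = holeDiff k i ∨ z = -holeDiff k i) := by
  by_contra! h
  have h0 := h.2 0
  have h1 := h.2 1
  have h2 := h.2 2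
  have h3 := h.2 3
  have h4 := h.2 4
  norm_num [holeDiff] at h0 h1 h2 h3 h4
  refine h.1 ⟨?_, ?_, ?_, ?_, ?_, ?_, ?_, ?_, ?_, ?_, ?_, ?_, ?_⟩ <;> omega

theorem holeDiff_spec (hk : 1 ≤ k) (i : ℤ) :
    0 < holeDiff k i ∧ holeDiff k i ≤ 12 * k + 2 ∧ holeDiff k i % 2 = 1 := by
  unfold holeDiff
  split_ifs <;> omega

theorem holeDiff_injective (hk : 1 ≤ k) {i j : ℤ} (hi : 0 ≤ i) (hi' : i < 5) (hj : 0 ≤ j)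
    (hj' : j < 5) (h : holeDiff k i = holeDiff k j) : i = j := by
  unfold holeDiff at h
  split_ifs at h <;> omega

theorem not_isBlockDiff_holeDiff (i : ℤ) : ¬IsBlockDiff k (holeDiff k i) := by
  unfold IsBlockDiff holeDiff
  split_ifs <;> omega

theorem not_isBlockDiff_neg_holeDiff (i : ℤ) : ¬IsBlockDiff k (-holeDiff k i) := fun h =>
  not_isBlockDiff_holeDiff i (by simpa using h.neg)

theorem OuterRel.swap_left (hk : 1 ≤ k) (hu : (u : ℤ) = 12 * k + 8) (h : OuterRel k p q r) :
    OuterRel k q p r := by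
  obtain ⟨hp, hq, hr, z, hz, hpq, hpr⟩ := h
  have hn := (hz.neg).thirdDiff hk
  have e := thirdDiff_neg hz
  refine ⟨hq, hp, hr, -z, hz.neg, hpq.symm, ?_⟩
  rw [e] at hn ⊢
  exact hpq.sub hu hq hr hpr hn.1 hn.2.1

theorem OuterRel.swap_right (hk : 1 ≤ k) (h : OuterRel k p q r) : OuterRel k p r q := by
  obtain ⟨hp, hq, hr, z, hz, hpq, hpr⟩ := h
  exact ⟨hp, hr, hq, _, hz.thirdDiff hk, hpr, by rwa [thirdDiff_thirdDiff hk hz]⟩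

theorem HoleRel.swap_right (hk : 1 ≤ k) (h : HoleRel k p q r) : HoleRel k p r q := by
  have := holeDiff_spec hk p.1
  have := p.2.2.val_lt
  have := q.2.2.val_lt
  have := r.2.2.val_lt
  obtain ⟨hp, hq, hr, ⟨hs, h⟩ | ⟨hs, h⟩⟩ := h
  · exact ⟨hp, hr, hq, .inr ⟨by unfold HasDiff at h; omega, h.symm⟩⟩
  · exact ⟨hp, hr, hq, .inl ⟨by unfold HasDiff at h; omega, by simpa using h.symm⟩⟩

theorem HoleRel.hasDiff (h : HoleRel k p q r) :
    HasDiff k q r (holeDiff k p.1) ∨ HasDiff k q r (-holeDiff k p.1) :=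
  h.2.2.2.imp And.right And.right

theorem HoleRel.third_unique (hu : (u : ℤ) = 12 * k + 8) {r' : Fin u × Fin 1 × ZMod 2}
    (h : HoleRel k p q r) (h' : HoleRel k p q r') : r = r' := by
  obtain ⟨-, -, hr, ⟨hs, h⟩ | ⟨hs, h⟩⟩ := h <;>
    obtain ⟨-, -, hr', ⟨hs', h'⟩ | ⟨hs', h'⟩⟩ := h' <;>
    first
    | contradiction
    | exact h.point_unique hu hr hr' h'

theorem HoleRel.hole_unique (hk : 1 ≤ k) {p' : Fin u × Fin 1 × ZMod 2}
    (h : HoleRel k p q r) (h' : HoleRel k p' q r) : p = p' := by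
  have h₁ := holeDiff_spec hk p.1
  have h₂ := holeDiff_spec hk p'.1
  have := p.2.2.val_lt
  have := p'.2.2.val_lt
  have := q.2.2.val_lt
  obtain ⟨hp, -, -, ⟨hs, h⟩ | ⟨hs, h⟩⟩ := h <;>
    obtain ⟨hp', -, -, ⟨hs', h'⟩ | ⟨hs', h'⟩⟩ := h' <;>
    have e := h.unique h' (by omega) (by omega) (by omega) (by omega)
  · exact point_ext (holeDiff_injective hk (by omega) hp (by omega) hp' e) (by omega)
  · omega
  · omega
  · exact point_ext (holeDiff_injective hk (by omega) hp (by omega) hp' (by omega)) (by omega)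

theorem OuterRel.third_unique (hu : (u : ℤ) = 12 * k + 8) {r' : Fin u × Fin 1 × ZMod 2}
    (h : OuterRel k p q r) (h' : OuterRel k p q r') : r = r' := by
  obtain ⟨-, -, hr, z, hz, hpq, hpr⟩ := h
  obtain ⟨-, -, hr', z', hz', hpq', hpr'⟩ := h'
  obtain rfl := hpq.unique hpq' hz.1 hz.2.1 hz'.1 hz'.2.1
  exact hpr.point_unique hu hr hr' hpr'

theorem OuterRel.not_holeRel (hk : 1 ≤ k) {r' : Fin u × Fin 1 × ZMod 2}
    (h : OuterRel k p q r) : ¬HoleRel k r' p q := by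
  intro h'
  obtain ⟨-, -, -, z, hz, hpq, -⟩ := h
  have := holeDiff_spec hk r'.1
  rcases h'.hasDiff with h' | h' <;>
    obtain rfl := hpq.unique h' hz.1 hz.2.1 (by omega) (by omega)
  · exact not_isBlockDiff_holeDiff _ hz
  · exact not_isBlockDiff_neg_holeDiff _ hz

theorem HasDiff.ne_of_ne_zero (h : HasDiff k p q z) (h₁ : -(12 * k + 2) ≤ z)
    (h₂ : z ≤ 12 * k + 2) (h₀ : z ≠ 0) : (p.1 : ℤ) ≠ q.1 := by
  unfold HasDiff at h
  omega

theorem BlockRel.admissible (hk : 1 ≤ k) (h : BlockRel k p q r) :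
    (p.1 : ℤ) ≠ q.1 ∧ ¬((p.1 : ℤ) < 5 ∧ (q.1 : ℤ) < 5) := by
  rcases h with ⟨hp, -, -, z, hz, hpq, -⟩ | ⟨hp, hq, -⟩ | ⟨hq, hp, -⟩ | h
  · exact ⟨hpq.ne_of_ne_zero hz.1 hz.2.1 hz.2.2.1, by omega⟩
  · omega
  · omega
  · have := holeDiff_spec hk r.1
    have := h.2.1
    rcases h.hasDiff with h | h <;>
      exact ⟨h.ne_of_ne_zero (by omega) (by omega) (by omega), by omega⟩

theorem exists_holeRel_right (hk : 1 ≤ k) (hu : (u : ℤ) = 12 * k + 8) (hp : (p.1 : ℤ) < 5)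
    (hq : 5 ≤ (q.1 : ℤ)) : ∃ r, HoleRel k p q r := by
  have := holeDiff_spec hk p.1
  by_cases hs : q.2.2.val = p.2.2.val
  · obtain ⟨r, hr, h⟩ := HasDiff.exists_point (z := holeDiff k p.1) hu hq (by omega) (by omega)
    exact ⟨r, hp, hq, hr, .inl ⟨hs, h⟩⟩
  · obtain ⟨r, hr, h⟩ := HasDiff.exists_point (z := -holeDiff k p.1) hu hq (by omega) (by omega)
    exact ⟨r, hp, hq, hr, .inr ⟨hs, h⟩⟩

theorem exists_blockRel (hk : 1 ≤ k) (hu : (u : ℤ) = 12 * k + 8) (hpq : (p.1 : ℤ) ≠ q.1)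
    (hhole : ¬((p.1 : ℤ) < 5 ∧ (q.1 : ℤ) < 5)) : ∃ r, BlockRel k p q r := by
  rcases lt_or_ge (p.1 : ℤ) 5 with hp | hp
  · obtain ⟨r, hr⟩ := exists_holeRel_right hk hu hp (q := q) (by omega)
    exact ⟨r, .inr (.inl hr)⟩
  rcases lt_or_ge (q.1 : ℤ) 5 with hq | hq
  · obtain ⟨r, hr⟩ := exists_holeRel_right hk hu hq hp
    exact ⟨r, .inr (.inr (.inl hr))⟩
  obtain ⟨z, hz, h₁, h₂, h₀⟩ := exists_hasDiff hu hp hq hpq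
  rcases isBlockDiff_or_holeDiff h₁ h₂ h₀ with hb | ⟨i, hi, hi', h | h⟩
  · have hb' := hb.thirdDiff hk
    obtain ⟨r, hr, h⟩ := HasDiff.exists_point hu hp hb'.1 hb'.2.1
    exact ⟨r, .inl ⟨hp, hq, hr, z, hb, hz, h⟩⟩
  · obtain ⟨r, hr, hs⟩ := exists_point (u := u) i p.2.2.val hi (by omega)
    have := p.2.2.val_lt
    have := r.2.2.val_lt
    exact ⟨r, .inr (.inr (.inr ⟨by omega, hp, hq, .inl ⟨by omega, by rwa [hr, ← h]⟩⟩))⟩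
  · obtain ⟨r, hr, hs⟩ := exists_point (u := u) i (p.2.2.val + 1) hi (by omega)
    exact ⟨r, .inr (.inr (.inr ⟨by omega, hp, hq, .inr ⟨by omega, by rwa [hr, ← h]⟩⟩))⟩

theorem BlockRel.third_unique (hk : 1 ≤ k) (hu : (u : ℤ) = 12 * k + 8)
    {r' : Fin u × Fin 1 × ZMod 2} (h : BlockRel k p q r) (h' : BlockRel k p q r') : r = r' := by
  rcases h with h | h | h | h <;> rcases h' with h' | h' | h' | h' <;>
    first
    | exact h.third_unique hu h'
    | exact h.hole_unique hk h'
    | exact absurd h' (h.not_holeRel hk)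
    | exact absurd h (h'.not_holeRel hk)
    | (have := h.1; have := h.2.1; have := h.2.2.1
       have := h'.1; have := h'.2.1; have := h'.2.2.1
       omega)

theorem HasDiff.shift (h : HasDiff k p q z) :
    HasDiff k (p.1, p.2.1, p.2.2 + 1) (q.1, q.2.1, q.2.2 + 1) z := by
  unfold HasDiff at *
  simp only [val_add_one]
  omega

theorem OuterRel.shift (h : OuterRel k p q r) : OuterRel k (p.1, p.2.1, p.2.2 + 1)
    (q.1, q.2.1, q.2.2 + 1) (r.1, r.2.1, r.2.2 + 1) := by
  obtain ⟨hp, hq, hr, z, hz, hpq, hpr⟩ := h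
  exact ⟨hp, hq, hr, z, hz, hpq.shift, hpr.shift⟩

theorem HoleRel.shift (h : HoleRel k p q r) : HoleRel k (p.1, p.2.1, p.2.2 + 1)
    (q.1, q.2.1, q.2.2 + 1) (r.1, r.2.1, r.2.2 + 1) := by
  have h₁ := val_add_one p.2.2
  have h₂ := val_add_one q.2.2
  obtain ⟨hp, hq, hr, ⟨hs, h⟩ | ⟨hs, h⟩⟩ := h
  · exact ⟨hp, hq, hr, .inl ⟨by dsimp only; omega, h.shift⟩⟩
  · exact ⟨hp, hq, hr, .inr ⟨by dsimp only; omega, h.shift⟩⟩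

end

end CyclicIGDD

/-- For every integer u with u ≡ 8 (mod 12) and u ≥ 20, there
exists a 2-cyclic 3-IGDD of type 2^{(u,5)} (the case g = 1, h = 2, t = 5). -/
theorem exists_cyclic_igdd_2_u_5
    (u : ℕ) (hmod : u % 12 = 8) (hu : 20 ≤ u) :
    ∃ ℬ : Finset (Finset (Fin u × Fin 1 × ZMod 2)),
      IsCyclicIGDDcol u 1 2 5 ℬ := by
  obtain ⟨k, hk, hk'⟩ : ∃ k : ℤ, 1 ≤ k ∧ (u : ℤ) = 12 * k + 8 := ⟨(u / 12 : ℕ), by omega⟩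
  refine exists_isCyclicIGDDcol_of_rel (CyclicIGDD.BlockRel k) ?_ ?_ ?_ ?_ ?_ ?_
  · rintro p q r (h | h | h | h)
    · exact .inl (h.swap_left hk hk')
    · exact .inr (.inr (.inl h))
    · exact .inr (.inl h)
    · exact .inr (.inr (.inr (h.swap_right hk)))
  · rintro p q r (h | h | h | h)
    · exact .inl (h.swap_right hk)
    · exact .inr (.inl (h.swap_right hk))
    · exact .inr (.inr (.inr h))
    · exact .inr (.inr (.inl h))
  · intro p q r h
    have := h.admissible hk
    exact ⟨fun e => this.1 (by rw [e]), by omega⟩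
  · intro p q hpq hhole
    exact CyclicIGDD.exists_blockRel hk hk' (fun e => hpq (Fin.ext (by omega))) (by omega)
  · intro p q r r' h h'
    exact h.third_unique hk hk' h'
  · rintro p q r (h | h | h | h)
    · exact .inl h.shift
    · exact .inr (.inl h.shift)
    · exact .inr (.inr (.inl h.shift))
    · exact .inr (.inr (.inr h.shift))
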